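/- Fix an integer t ≥ 0 and τ > 0; let a_n = 100 n² and define V_n : [0,1] → [0,∞]^{t+1} by (V_n(x))_j = τ^{−1} (ψ(f^j(x))/a_n)^{−1/2} for 0 ≤ j ≤ t, with the convention that the value is ∞ when ψ(f^j(x)) = 0. Then the law of V_n under Leb conditioned on the event {x : ψ(x) > τ^{−2} a_n} converges weakly, as n → ∞, to the law of the random vector (Y_j)_{0≤j≤t} defined as follows: let U be uniform on [0,1] and, independently, let K ∈ {1,2,3} with P(K=1) = 1/5, P(K=2) = 3/5, P(K=3) = 1/5; if K = 1 then Y₀ = U, Y₁ = (2/3)U, Y₃ = 8U and Y_j = ∞ for all other j ≤ t; if K = 2 then Y₀ = U, Y₂ = 12U and Y_j = ∞ for all other j ≤ t; if K = 3 then Y₀ = U and Y_j = ∞ for all 1 ≤ j ≤ t. (These are the forward finite-dimensional distributions of the process (Y_j) from which the piling process of the weighted example is obtained by conditioning.) -/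

import Mathlib

open MeasureTheory Filter Set
open scoped ENNReal

/-- The doubling map `f(x) = 2x mod 1`. -/
noncomputable def fD : ℝ → ℝ := fun x => Int.fract (2 * x)

/-- `ξ₁ = ζ = √2/16`. -/
noncomputable def xi1 : ℝ := Real.sqrt 2 / 16
/-- `ξ₂ = f(ζ) = √2/8`. -/
noncomputable def xi2 : ℝ := Real.sqrt 2 / 8
/-- `ξ₃ = f³(ζ) = √2/2`. -/
noncomputable def xi3 : ℝ := Real.sqrt 2 / 2

/-- The uniform distribution on `[0,1]`. -/
noncomputable def unif01 : Measure ℝ := volume.restrict (Icc (0:ℝ) 1)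

/-- Branch `K = 1` of the limit: `Y₀ = U`, `Y₁ = (2/3)U`, `Y₃ = 8U`, `Y_j = ∞` otherwise. -/
noncomputable def g1 (t : ℕ) : ℝ → (Fin (t + 1) → ℝ≥0∞) := fun u j =>
  if (j : ℕ) = 0 then ENNReal.ofReal u
  else if (j : ℕ) = 1 then ENNReal.ofReal ((2 / 3) * u)
  else if (j : ℕ) = 3 then ENNReal.ofReal (8 * u)
  else ⊤

/-- Branch `K = 2` of the limit: `Y₀ = U`, `Y₂ = 12U`, `Y_j = ∞` otherwise. -/
noncomputable def g2 (t : ℕ) : ℝ → (Fin (t + 1) → ℝ≥0∞) := fun u j =>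
  if (j : ℕ) = 0 then ENNReal.ofReal u
  else if (j : ℕ) = 2 then ENNReal.ofReal (12 * u)
  else ⊤

/-- Branch `K = 3` of the limit: `Y₀ = U`, `Y_j = ∞` for `j ≥ 1`. -/
noncomputable def g3 (t : ℕ) : ℝ → (Fin (t + 1) → ℝ≥0∞) := fun u j =>
  if (j : ℕ) = 0 then ENNReal.ofReal u else ⊤

/-- The law of the random vector `(Y_j)_{0 ≤ j ≤ t}`: the three branches have probabilities
`1/5`, `3/5`, `1/5` and are driven by a uniform random variable `U` on `[0,1]`. -/
noncomputable def limitLaw16 (t : ℕ) : Measure (Fin (t + 1) → ℝ≥0∞) :=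
  ((1 : ℝ≥0∞) / 5) • unif01.map (g1 t) + ((3 : ℝ≥0∞) / 5) • unif01.map (g2 t) +
    ((1 : ℝ≥0∞) / 5) • unif01.map (g3 t)

/-- The coordinate value `τ⁻¹ (p / (100 n²))^{-1/2}`, equal to `∞` when `p = 0`. -/
noncomputable def scaledInv (τ : ℝ) (n : ℕ) (p : ℝ) : ℝ≥0∞ :=
  if p = 0 then ⊤ else ENNReal.ofReal (τ⁻¹ * (p / (100 * (n : ℝ) ^ 2)) ^ (-(1/2) : ℝ))

lemma measurable_scaledInv (τ : ℝ) (n : ℕ) : Measurable (scaledInv τ n) := by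
  unfold scaledInv
  exact Measurable.ite (measurableSet_singleton 0) measurable_const (by fun_prop)

lemma rpow_neg_half_div {a : ℝ} (ha : 0 ≤ a) (n : ℕ) :
    (a ^ 2 / (100 * (n : ℝ) ^ 2)) ^ (-(1/2) : ℝ) = 10 * n / a := by
  have : a ^ 2 / (100 * (n : ℝ) ^ 2) = (a / (10 * n)) ^ 2 := by
    rw [div_pow]; ring
  rw [this, Real.rpow_neg (by positivity), ← Real.sqrt_eq_rpow, Real.sqrt_sq (by positivity),
    inv_div]

lemma sq_mul_zpow_neg_two (c d : ℝ) : c ^ 2 * d ^ (-2 : ℤ) = (c / d) ^ 2 := by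
  rw [zpow_neg, div_pow, div_eq_mul_inv]; norm_cast

lemma threshold_lt_iff {τ c d : ℝ} (hτ : 0 < τ) (hc : 0 < c) (hd : 0 ≤ d) {n : ℕ} (hn : 0 < n) :
    τ ^ (-2 : ℤ) * (100 * (n : ℝ) ^ 2) < c ^ 2 * d ^ (-2 : ℤ) ↔
      d ≠ 0 ∧ d < c * τ / (10 * n) := by
  have hn' : (0 : ℝ) < n := by exact_mod_cast hn
  have h : τ ^ (-2 : ℤ) * (100 * (n : ℝ) ^ 2) = (10 * n / τ) ^ 2 := by
    rw [← sq_mul_zpow_neg_two]; ring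
  rw [h, sq_mul_zpow_neg_two, sq_lt_sq₀ (by positivity) (by positivity)]
  rcases hd.eq_or_lt with rfl | hd
  · simp only [div_zero, ne_eq, not_true_eq_false, false_and, iff_false, not_lt]
    positivity
  · rw [div_lt_div_iff₀ hτ hd, lt_div_iff₀ (by positivity)]
    simp only [ne_eq, hd.ne', not_false_eq_true, true_and]
    rw [mul_comm d]

lemma tendsto_scaledInv_of_pole {ψ : ℝ → ℝ} {τ y c ε v : ℝ} (hτ : 0 < τ) (hc : 0 < c)
    (hε : 0 < ε) (hv : 0 < v) (hψ : ∀ x ∈ Metric.ball y ε, ψ x = c ^ 2 * |x - y| ^ (-2 : ℤ))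
    {z : ℕ → ℝ} (hz : Tendsto z atTop (nhds y))
    (hzy : ∀ᶠ n : ℕ in atTop, |z n - y| = c * v * τ / (10 * n)) :
    Tendsto (fun n => scaledInv τ n (ψ (z n))) atTop (nhds (ENNReal.ofReal v)) := by
  refine tendsto_const_nhds.congr' ?_
  filter_upwards [hzy, hz.eventually (Metric.ball_mem_nhds y hε), eventually_gt_atTop 0]
    with n hn hb hn0
  have hn' : (0 : ℝ) < n := by exact_mod_cast hn0
  have hp : 0 < c / (c * v * τ / (10 * n)) := by positivity
  rw [hψ _ hb, hn, sq_mul_zpow_neg_two, scaledInv, if_neg (by positivity),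
    rpow_neg_half_div hp.le]
  congr 1
  field_simp

lemma tendsto_scaledInv_of_bounded {τ M : ℝ} (hτ : 0 < τ) {p : ℕ → ℝ}
    (hp : ∀ n, 0 ≤ p n) (hM : ∀ᶠ n in atTop, p n ≤ M) :
    Tendsto (fun n => scaledInv τ n (p n)) atTop (nhds ⊤) := by
  set a := Real.sqrt (max M 1) with ha
  have ha0 : 0 < a := Real.sqrt_pos.2 (by positivity)
  have hsq : a ^ 2 = max M 1 := Real.sq_sqrt (by positivity)
  have hlim : Tendsto (fun n : ℕ => ENNReal.ofReal (τ⁻¹ * (10 * n / a))) atTop (nhds ⊤) := by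
    refine ENNReal.tendsto_ofReal_nhds_top.2 ?_
    have : Tendsto (fun n : ℕ => (τ⁻¹ * 10 / a) * (n : ℝ)) atTop atTop :=
      tendsto_natCast_atTop_atTop.const_mul_atTop (by positivity)
    exact this.congr fun n => by ring
  refine tendsto_nhds_top_mono hlim ?_
  filter_upwards [hM, eventually_gt_atTop 0] with n hn hn0
  have hn' : (0 : ℝ) < n := by exact_mod_cast hn0
  unfold scaledInv
  split_ifs with h
  · exact le_top
  · have h0 : 0 < p n := lt_of_le_of_ne (hp n) (Ne.symm h)
    rw [← rpow_neg_half_div ha0.le]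
    refine ENNReal.ofReal_le_ofReal (mul_le_mul_of_nonneg_left ?_ (by positivity))
    refine Real.rpow_le_rpow_of_nonpos (by positivity) ?_ (by norm_num)
    gcongr
    rw [hsq]
    exact hn.trans (le_max_left _ _)

lemma measurable_fD : Measurable fD := by
  unfold fD; exact measurable_fract.comp (measurable_const_mul 2)

lemma fD_iterate_eq_sub_intCast (x : ℝ) (j : ℕ) : ∃ m : ℤ, fD^[j] x = 2 ^ j * x - m := by
  induction j with
  | zero => exact ⟨0, by simp⟩
  | succ j ih =>
    obtain ⟨m, hm⟩ := ih
    refine ⟨2 * m + ⌊2 * (2 ^ j * x - m)⌋, ?_⟩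
    rw [Function.iterate_succ_apply', hm, fD, Int.fract]
    push_cast; ring

lemma irrational_fD_iterate {x : ℝ} (hx : Irrational x) (j : ℕ) : Irrational (fD^[j] x) := by
  obtain ⟨m, hm⟩ := fD_iterate_eq_sub_intCast x j
  rw [hm]
  have := (hx.natCast_mul (m := 2 ^ j) (by positivity)).sub_intCast m
  push_cast at this
  exact this

lemma eventually_fD_add {y : ℝ} (hy : Irrational y) :
    ∀ᶠ δ : ℝ in nhds 0, fD (y + δ) = fD y + 2 * δ := by
  have h2 : Irrational (2 * y) := by
    have := hy.natCast_mul (m := 2) (by norm_num)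
    exact_mod_cast this
  have hl : ((⌊2 * y⌋ : ℤ) : ℝ) < 2 * y :=
    lt_of_le_of_ne (Int.floor_le _) (fun h => h2.ne_int _ h.symm)
  have hr : 2 * y < (⌊2 * y⌋ : ℝ) + 1 := Int.lt_floor_add_one _
  have hc : Tendsto (fun δ : ℝ => 2 * (y + δ)) (nhds 0) (nhds (2 * y)) := by
    have : Continuous fun δ : ℝ => 2 * (y + δ) := by fun_prop
    simpa using this.tendsto 0
  filter_upwards [hc.eventually (Ioo_mem_nhds hl hr)] with δ hδ
  have : ⌊2 * (y + δ)⌋ = ⌊2 * y⌋ := Int.floor_eq_iff.2 ⟨hδ.1.le, hδ.2⟩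
  simp only [fD, Int.fract, this]
  ring

lemma eventually_fD_iterate_add {x : ℝ} (hx : Irrational x) (j : ℕ) :
    ∀ᶠ δ : ℝ in nhds 0, fD^[j] (x + δ) = fD^[j] x + 2 ^ j * δ := by
  induction j with
  | zero => simp
  | succ j ih =>
    have hc : Tendsto (fun δ : ℝ => (2 : ℝ) ^ j * δ) (nhds 0) (nhds 0) := by
      have : Continuous fun δ : ℝ => (2 : ℝ) ^ j * δ := by fun_prop
      simpa using this.tendsto 0
    filter_upwards [ih, hc.eventually (eventually_fD_add (irrational_fD_iterate hx j))]
      with δ h1 h2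
    rw [Function.iterate_succ_apply', Function.iterate_succ_apply', h1, h2]
    ring

lemma two_pow_mul_eq_of_fD_iterate_eq {j : ℕ} {p q : ℚ}
    (h : fD^[j] (Real.sqrt 2 * p) = Real.sqrt 2 * q) : 2 ^ j * p = q := by
  obtain ⟨m, hm⟩ := fD_iterate_eq_sub_intCast (Real.sqrt 2 * p) j
  by_contra hne
  have hne' : 2 ^ j * p - q ≠ 0 := sub_ne_zero.2 hne
  refine (irrational_sqrt_two.mul_ratCast hne').ne_int m ?_
  push_cast
  linear_combination h - hm

lemma xi1_eq : xi1 = Real.sqrt 2 * ((1 / 16 : ℚ) : ℝ) := by unfold xi1; push_cast; ring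
lemma xi2_eq : xi2 = Real.sqrt 2 * ((1 / 8 : ℚ) : ℝ) := by unfold xi2; push_cast; ring
lemma xi3_eq : xi3 = Real.sqrt 2 * ((1 / 2 : ℚ) : ℝ) := by unfold xi3; push_cast; ring

lemma irrational_xi1 : Irrational xi1 :=
  xi1_eq ▸ irrational_sqrt_two.mul_ratCast (by norm_num)
lemma irrational_xi2 : Irrational xi2 :=
  xi2_eq ▸ irrational_sqrt_two.mul_ratCast (by norm_num)
lemma irrational_xi3 : Irrational xi3 :=
  xi3_eq ▸ irrational_sqrt_two.mul_ratCast (by norm_num)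

lemma fD_eq_two_mul {x : ℝ} (h0 : 0 ≤ x) (h1 : 2 * x < 1) : fD x = 2 * x :=
  Int.fract_eq_self.2 ⟨by positivity, h1⟩

lemma sqrt_two_lt_two : Real.sqrt 2 < 2 :=
  (Real.sqrt_lt' (by norm_num)).2 (by norm_num)

lemma fD_xi1 : fD xi1 = xi2 := by
  have := sqrt_two_lt_two
  rw [fD_eq_two_mul] <;> unfold xi1
  · unfold xi2; ring
  · positivity
  · linarith

lemma fD_fD_xi2 : fD (fD xi2) = xi3 := by
  have := sqrt_two_lt_two
  have h : fD xi2 = Real.sqrt 2 / 4 := by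
    rw [fD_eq_two_mul] <;> unfold xi2
    · ring
    · positivity
    · linarith
  rw [h, fD_eq_two_mul]
  · unfold xi3; ring
  · positivity
  · linarith

/-- The observable of the example, with its defining properties. -/
structure IsObservable (ψ : ℝ → ℝ) (ε₁ ε₂ ε₃ : ℝ) : Prop where
  pos₁ : 0 < ε₁
  pos₂ : 0 < ε₂
  pos₃ : 0 < ε₃
  eq₁ : ∀ x ∈ Metric.ball xi1 ε₁, ψ x = 1 ^ 2 * |x - xi1| ^ (-2 : ℤ)
  eq₂ : ∀ x ∈ Metric.ball xi2 ε₂, ψ x = 3 ^ 2 * |x - xi2| ^ (-2 : ℤ)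
  eq₃ : ∀ x ∈ Metric.ball xi3 ε₃, ψ x = 1 ^ 2 * |x - xi3| ^ (-2 : ℤ)
  eq₀ : ∀ x, x ∉ Metric.ball xi1 ε₁ → x ∉ Metric.ball xi2 ε₂ → x ∉ Metric.ball xi3 ε₃ → ψ x = 0

namespace IsObservable

variable {ψ : ℝ → ℝ} {ε₁ ε₂ ε₃ : ℝ}

lemma measurable (h : IsObservable ψ ε₁ ε₂ ε₃) : Measurable ψ := by
  classical
  have : ψ = fun x => if x ∈ Metric.ball xi1 ε₁ then 1 ^ 2 * |x - xi1| ^ (-2 : ℤ)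
      else if x ∈ Metric.ball xi2 ε₂ then 3 ^ 2 * |x - xi2| ^ (-2 : ℤ)
      else if x ∈ Metric.ball xi3 ε₃ then 1 ^ 2 * |x - xi3| ^ (-2 : ℤ) else 0 := by
    funext x
    split_ifs with h1 h2 h3
    exacts [h.eq₁ x h1, h.eq₂ x h2, h.eq₃ x h3, h.eq₀ x h1 h2 h3]
  have hm : ∀ c y : ℝ, Measurable fun x : ℝ => c ^ 2 * |x - y| ^ (-2 : ℤ) := fun c y => by
    simp only [sq_mul_zpow_neg_two]
    exact ((measurable_id.sub_const y).norm.const_div c).pow_const 2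
  rw [this]
  exact (hm _ _).ite measurableSet_ball
    ((hm _ _).ite measurableSet_ball ((hm _ _).ite measurableSet_ball measurable_const))

lemma nonneg (h : IsObservable ψ ε₁ ε₂ ε₃) (x : ℝ) : 0 ≤ ψ x := by
  by_cases h1 : x ∈ Metric.ball xi1 ε₁
  · rw [h.eq₁ x h1]; positivity
  by_cases h2 : x ∈ Metric.ball xi2 ε₂
  · rw [h.eq₂ x h2]; positivity
  by_cases h3 : x ∈ Metric.ball xi3 ε₃
  · rw [h.eq₃ x h3]; positivity
  exact (h.eq₀ x h1 h2 h3).ge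

lemma le_sum (h : IsObservable ψ ε₁ ε₂ ε₃) (x : ℝ) :
    ψ x ≤ 1 ^ 2 * |x - xi1| ^ (-2 : ℤ) + 3 ^ 2 * |x - xi2| ^ (-2 : ℤ)
      + 1 ^ 2 * |x - xi3| ^ (-2 : ℤ) := by
  have p1 : 0 ≤ (1 : ℝ) ^ 2 * |x - xi1| ^ (-2 : ℤ) := by positivity
  have p2 : 0 ≤ (3 : ℝ) ^ 2 * |x - xi2| ^ (-2 : ℤ) := by positivity
  have p3 : 0 ≤ (1 : ℝ) ^ 2 * |x - xi3| ^ (-2 : ℤ) := by positivity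
  by_cases h1 : x ∈ Metric.ball xi1 ε₁
  · rw [h.eq₁ x h1]; linarith
  by_cases h2 : x ∈ Metric.ball xi2 ε₂
  · rw [h.eq₂ x h2]; linarith
  by_cases h3 : x ∈ Metric.ball xi3 ε₃
  · rw [h.eq₃ x h3]; linarith
  rw [h.eq₀ x h1 h2 h3]; linarith

lemma tendsto_scaledInv_top (h : IsObservable ψ ε₁ ε₂ ε₃) {τ y : ℝ} (hτ : 0 < τ)
    (h1 : y ≠ xi1) (h2 : y ≠ xi2) (h3 : y ≠ xi3) {z : ℕ → ℝ} (hz : Tendsto z atTop (nhds y)) :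
    Tendsto (fun n => scaledInv τ n (ψ (z n))) atTop (nhds ⊤) := by
  have hc : ∀ c ξ : ℝ, y ≠ ξ → ContinuousAt (fun x : ℝ => c ^ 2 * |x - ξ| ^ (-2 : ℤ)) y :=
    fun c ξ hξ => continuousAt_const.mul
      (ContinuousAt.zpow₀ (by fun_prop) _ (Or.inl (abs_ne_zero.2 (sub_ne_zero.2 hξ))))
  have hcont := ((hc 1 _ h1).add (hc 3 _ h2)).add (hc 1 _ h3)
  obtain ⟨M, hM⟩ := exists_gt (((fun x : ℝ => (1 : ℝ) ^ 2 * |x - xi1| ^ (-2 : ℤ)) +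
    (fun x : ℝ => (3 : ℝ) ^ 2 * |x - xi2| ^ (-2 : ℤ)) +
    fun x : ℝ => (1 : ℝ) ^ 2 * |x - xi3| ^ (-2 : ℤ)) y)
  refine tendsto_scaledInv_of_bounded (M := M) hτ (fun n => h.nonneg _) ?_
  filter_upwards [(hcont.tendsto.comp hz).eventually (gt_mem_nhds hM)] with n hn
  exact (h.le_sum _).trans hn.le

end IsObservable

section Orbit

variable {x : ℝ} {δ : ℕ → ℝ}

lemma tendsto_fD_iterate_add (hx : Irrational x) (hδ : Tendsto δ atTop (nhds 0)) (j : ℕ) :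
    Tendsto (fun n => fD^[j] (x + δ n)) atTop (nhds (fD^[j] x)) := by
  have h : Tendsto (fun n => fD^[j] x + 2 ^ j * δ n) atTop (nhds (fD^[j] x)) := by
    simpa using (hδ.const_mul (2 ^ j)).const_add (fD^[j] x)
  refine h.congr' ?_
  filter_upwards [hδ.eventually (eventually_fD_iterate_add hx j)] with n hn
  exact hn.symm

lemma tendsto_scaledInv_fD_iterate {ψ : ℝ → ℝ} {τ y c v w ε : ℝ} (hτ : 0 < τ) (hc : 0 < c)
    (hε : 0 < ε) (hw : 0 < w) (hx : Irrational x)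
    (hψ : ∀ x ∈ Metric.ball y ε, ψ x = c ^ 2 * |x - y| ^ (-2 : ℤ))
    (hδ : Tendsto δ atTop (nhds 0)) (hδv : ∀ n : ℕ, |δ n| = v * τ / (10 * n)) {j : ℕ}
    (hj : fD^[j] x = y) (hvw : 2 ^ j * v = c * w) :
    Tendsto (fun n => scaledInv τ n (ψ (fD^[j] (x + δ n)))) atTop (nhds (ENNReal.ofReal w)) := by
  refine tendsto_scaledInv_of_pole hτ hc hε hw hψ (hj ▸ tendsto_fD_iterate_add hx hδ j) ?_
  filter_upwards [hδ.eventually (eventually_fD_iterate_add hx j)] with n hn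
  rw [hn, hj, add_sub_cancel_left, abs_mul, hδv, abs_of_pos (by positivity), ← hvw]
  ring

end Orbit

lemma tendsto_div_ten_mul_natCast (a : ℝ) :
    Tendsto (fun n : ℕ => a / (10 * (n : ℝ))) atTop (nhds 0) :=
  tendsto_const_nhds.div_atTop (tendsto_natCast_atTop_atTop.const_mul_atTop (by norm_num))

lemma abs_mul_div_mul {c τ : ℝ} (hc : 0 < c) (hτ : 0 < τ) (u : ℝ) (n : ℕ) :
    |c * τ / (10 * n) * u| = (c * |u|) * τ / (10 * n) := by
  rw [abs_mul, abs_of_nonneg (by positivity)]; ring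

namespace IsObservable

variable {ψ : ℝ → ℝ} {ε₁ ε₂ ε₃ τ u : ℝ}

lemma tendsto_branch₁ (h : IsObservable ψ ε₁ ε₂ ε₃) (hτ : 0 < τ) (hu : u ≠ 0) (t : ℕ) :
    Tendsto (fun n : ℕ => fun j : Fin (t + 1) =>
      scaledInv τ n (ψ (fD^[(j : ℕ)] (xi1 + 1 * τ / (10 * n) * u)))) atTop
      (nhds (g1 t |u|)) := by
  have hu' : 0 < |u| := abs_pos.2 hu
  have hδ : Tendsto (fun n : ℕ => 1 * τ / (10 * (n : ℝ)) * u) atTop (nhds 0) := by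
    simpa using (tendsto_div_ten_mul_natCast (1 * τ)).mul_const u
  refine tendsto_pi_nhds.2 fun j => ?_
  unfold g1
  split_ifs with h0 h1 h3
  · exact tendsto_scaledInv_fD_iterate hτ one_pos h.pos₁ hu' irrational_xi1 h.eq₁ hδ
      (abs_mul_div_mul one_pos hτ u) (by simp [h0]) (by simp [h0])
  · exact tendsto_scaledInv_fD_iterate hτ three_pos h.pos₂ (by positivity) irrational_xi1 h.eq₂ hδ
      (abs_mul_div_mul one_pos hτ u) (by simp [h1, fD_xi1]) (by rw [h1]; ring)
  · exact tendsto_scaledInv_fD_iterate hτ one_pos h.pos₃ (by positivity) irrational_xi1 h.eq₃ hδ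
      (abs_mul_div_mul one_pos hτ u) (by simp [h3, fD_xi1, fD_fD_xi2]) (by rw [h3]; ring)
  · refine h.tendsto_scaledInv_top hτ (y := fD^[(j : ℕ)] xi1) ?_ ?_ ?_
      (tendsto_fD_iterate_add irrational_xi1 hδ j)
    · intro hj
      rw [xi1_eq] at hj
      have := two_pow_mul_eq_of_fD_iterate_eq hj
      exact h0 (Nat.pow_right_injective le_rfl (by
        have : (2 : ℚ) ^ (j : ℕ) = 2 ^ 0 := by linarith
        exact_mod_cast this))
    · intro hj
      rw [xi1_eq, xi2_eq] at hj
      have := two_pow_mul_eq_of_fD_iterate_eq hj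
      exact h1 (Nat.pow_right_injective le_rfl (by
        have : (2 : ℚ) ^ (j : ℕ) = 2 ^ 1 := by linarith
        exact_mod_cast this))
    · intro hj
      rw [xi1_eq, xi3_eq] at hj
      have := two_pow_mul_eq_of_fD_iterate_eq hj
      exact h3 (Nat.pow_right_injective le_rfl (by
        have : (2 : ℚ) ^ (j : ℕ) = 2 ^ 3 := by linarith
        exact_mod_cast this))

lemma tendsto_branch₂ (h : IsObservable ψ ε₁ ε₂ ε₃) (hτ : 0 < τ) (hu : u ≠ 0) (t : ℕ) :
    Tendsto (fun n : ℕ => fun j : Fin (t + 1) =>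
      scaledInv τ n (ψ (fD^[(j : ℕ)] (xi2 + 3 * τ / (10 * n) * u)))) atTop
      (nhds (g2 t |u|)) := by
  have hu' : 0 < |u| := abs_pos.2 hu
  have hδ : Tendsto (fun n : ℕ => 3 * τ / (10 * (n : ℝ)) * u) atTop (nhds 0) := by
    simpa using (tendsto_div_ten_mul_natCast (3 * τ)).mul_const u
  refine tendsto_pi_nhds.2 fun j => ?_
  unfold g2
  split_ifs with h0 h2
  · exact tendsto_scaledInv_fD_iterate hτ three_pos h.pos₂ hu' irrational_xi2 h.eq₂ hδ
      (abs_mul_div_mul three_pos hτ u) (by simp [h0]) (by simp [h0])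
  · exact tendsto_scaledInv_fD_iterate hτ one_pos h.pos₃ (by positivity) irrational_xi2 h.eq₃ hδ
      (abs_mul_div_mul three_pos hτ u) (by simp [h2, fD_fD_xi2]) (by rw [h2]; ring)
  · have hp : (1 : ℚ) ≤ 2 ^ (j : ℕ) := one_le_pow₀ (by norm_num)
    refine h.tendsto_scaledInv_top hτ (y := fD^[(j : ℕ)] xi2) ?_ ?_ ?_
      (tendsto_fD_iterate_add irrational_xi2 hδ j)
    · intro hj
      rw [xi1_eq, xi2_eq] at hj
      have := two_pow_mul_eq_of_fD_iterate_eq hj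
      linarith
    · intro hj
      rw [xi2_eq] at hj
      have := two_pow_mul_eq_of_fD_iterate_eq hj
      exact h0 (Nat.pow_right_injective le_rfl (by
        have : (2 : ℚ) ^ (j : ℕ) = 2 ^ 0 := by linarith
        exact_mod_cast this))
    · intro hj
      rw [xi2_eq, xi3_eq] at hj
      have := two_pow_mul_eq_of_fD_iterate_eq hj
      exact h2 (Nat.pow_right_injective le_rfl (by
        have : (2 : ℚ) ^ (j : ℕ) = 2 ^ 2 := by linarith
        exact_mod_cast this))

lemma tendsto_branch₃ (h : IsObservable ψ ε₁ ε₂ ε₃) (hτ : 0 < τ) (hu : u ≠ 0) (t : ℕ) :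
    Tendsto (fun n : ℕ => fun j : Fin (t + 1) =>
      scaledInv τ n (ψ (fD^[(j : ℕ)] (xi3 + 1 * τ / (10 * n) * u)))) atTop
      (nhds (g3 t |u|)) := by
  have hu' : 0 < |u| := abs_pos.2 hu
  have hδ : Tendsto (fun n : ℕ => 1 * τ / (10 * (n : ℝ)) * u) atTop (nhds 0) := by
    simpa using (tendsto_div_ten_mul_natCast (1 * τ)).mul_const u
  refine tendsto_pi_nhds.2 fun j => ?_
  unfold g3
  split_ifs with h0
  · exact tendsto_scaledInv_fD_iterate hτ one_pos h.pos₃ hu' irrational_xi3 h.eq₃ hδ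
      (abs_mul_div_mul one_pos hτ u) (by simp [h0]) (by simp [h0])
  · have hp : (1 : ℚ) ≤ 2 ^ (j : ℕ) := one_le_pow₀ (by norm_num)
    refine h.tendsto_scaledInv_top hτ (y := fD^[(j : ℕ)] xi3) ?_ ?_ ?_
      (tendsto_fD_iterate_add irrational_xi3 hδ j)
    · intro hj
      rw [xi1_eq, xi3_eq] at hj
      have := two_pow_mul_eq_of_fD_iterate_eq hj
      linarith
    · intro hj
      rw [xi2_eq, xi3_eq] at hj
      have := two_pow_mul_eq_of_fD_iterate_eq hj
      linarith
    · intro hj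
      rw [xi3_eq] at hj
      have := two_pow_mul_eq_of_fD_iterate_eq hj
      exact h0 (Nat.pow_right_injective le_rfl (by
        have : (2 : ℚ) ^ (j : ℕ) = 2 ^ 0 := by linarith
        exact_mod_cast this))

end IsObservable

lemma setIntegral_ball_eq (F : ℝ → ℝ) (y : ℝ) {r : ℝ} (hr : 0 < r) :
    ∫ x in Metric.ball y r, F x = r * ∫ u in (-1 : ℝ)..1, F (y + r * u) := by
  rw [Real.ball_eq_Ioo, ← integral_Ioc_eq_integral_Ioo,
    ← intervalIntegral.integral_of_le (by linarith),
    intervalIntegral.integral_comp_add_mul F hr.ne', smul_eq_mul, mul_inv_cancel_left₀ hr.ne']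
  congr 1 <;> ring

lemma integral_comp_abs_neg_one_one {G : ℝ → ℝ} (hG : Measurable G) {C : ℝ}
    (hC : ∀ x, ‖G x‖ ≤ C) :
    ∫ u in (-1 : ℝ)..1, G |u| = 2 * ∫ u, G u ∂unif01 := by
  have hm : Measurable fun u : ℝ => G |u| := hG.comp measurable_norm
  have hi : ∀ a b : ℝ, IntervalIntegrable (fun u => G |u|) volume a b := fun a b =>
    (intervalIntegrable_const (c := C)).mono_fun hm.aestronglyMeasurable
      (ae_of_all _ fun x => (hC _).trans (le_abs_self C))
  have h1 : ∫ u in (0 : ℝ)..1, G |u| = ∫ u, G u ∂unif01 := by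
    rw [unif01, integral_Icc_eq_integral_Ioc, ← intervalIntegral.integral_of_le zero_le_one]
    refine intervalIntegral.integral_congr fun x hx => ?_
    rw [uIcc_of_le zero_le_one] at hx
    simp only [abs_of_nonneg hx.1]
  have h2 : ∫ u in (-1 : ℝ)..0, G |u| = ∫ u in (0 : ℝ)..1, G |u| := by
    have := intervalIntegral.integral_comp_neg (a := 0) (b := 1) (fun u : ℝ => G |u|)
    simpa using this.symm
  rw [← intervalIntegral.integral_add_adjacent_intervals (hi (-1) 0) (hi 0 1), h2, h1]
  ring

section Limits

variable {X : Type*} [TopologicalSpace X] [MeasurableSpace X] [OpensMeasurableSpace X]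

lemma tendsto_integral_branch (g : BoundedContinuousFunction X ℝ) {V : ℕ → ℝ → X}
    (hV : ∀ n, Measurable (V n)) {y : ℝ} {r : ℕ → ℝ} {G : ℝ → X} (hG : Measurable G)
    (hlim : ∀ u : ℝ, u ≠ 0 → Tendsto (fun n => V n (y + r n * u)) atTop (nhds (G |u|))) :
    Tendsto (fun n => ∫ u in (-1 : ℝ)..1, g (V n (y + r n * u))) atTop
      (nhds (2 * ∫ u, g (G u) ∂unif01)) := by
  have hg : Measurable g := g.continuous.measurable
  rw [← integral_comp_abs_neg_one_one (G := fun u => g (G u)) (hg.comp hG)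
    (fun x => g.norm_coe_le_norm _)]
  refine intervalIntegral.tendsto_integral_filter_of_dominated_convergence (fun _ => ‖g‖)
    (Eventually.of_forall fun n => ?_) (Eventually.of_forall fun n => ae_of_all _ fun x _ =>
      g.norm_coe_le_norm _) intervalIntegrable_const ?_
  · exact (hg.comp ((hV n).comp (by fun_prop))).aestronglyMeasurable
  · filter_upwards [compl_mem_ae_iff.2 (measure_singleton (0 : ℝ))] with u hu _
    exact (g.continuous.tendsto _).comp (hlim u hu)

end Limits

lemma measurable_g1 (t : ℕ) : Measurable (g1 t) := by
  refine measurable_pi_lambda _ fun j => ?_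
  unfold g1
  split_ifs <;> fun_prop

lemma measurable_g2 (t : ℕ) : Measurable (g2 t) := by
  refine measurable_pi_lambda _ fun j => ?_
  unfold g2
  split_ifs <;> fun_prop

lemma measurable_g3 (t : ℕ) : Measurable (g3 t) := by
  refine measurable_pi_lambda _ fun j => ?_
  unfold g3
  split_ifs <;> fun_prop

instance : IsFiniteMeasure unif01 := by unfold unif01; infer_instance

lemma integral_limitLaw16 (t : ℕ) (g : BoundedContinuousFunction (Fin (t + 1) → ℝ≥0∞) ℝ) :
    ∫ v, g v ∂(limitLaw16 t) =
      1 / 5 * ∫ u, g (g1 t u) ∂unif01 + 3 / 5 * ∫ u, g (g2 t u) ∂unif01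
        + 1 / 5 * ∫ u, g (g3 t u) ∂unif01 := by
  have hi : ∀ (a : ℝ≥0∞) (G : ℝ → Fin (t + 1) → ℝ≥0∞), a ≠ ⊤ →
      Integrable (fun v => g v) (a • unif01.map G) := fun a G ha =>
    (g.integrable _).smul_measure ha
  have h1 : (1 : ℝ≥0∞) / 5 ≠ ⊤ := ENNReal.div_ne_top (by simp) (by simp)
  have h3 : (3 : ℝ≥0∞) / 5 ≠ ⊤ := ENNReal.div_ne_top (by simp) (by simp)
  rw [limitLaw16, integral_add_measure ((hi _ _ h1).add_measure (hi _ _ h3)) (hi _ _ h1),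
    integral_add_measure (hi _ _ h1) (hi _ _ h3)]
  simp only [integral_smul_measure]
  rw [integral_map (measurable_g1 t).aemeasurable g.continuous.measurable.aestronglyMeasurable,
    integral_map (measurable_g2 t).aemeasurable g.continuous.measurable.aestronglyMeasurable,
    integral_map (measurable_g3 t).aemeasurable g.continuous.measurable.aestronglyMeasurable]
  simp [ENNReal.toReal_div]

lemma integral_cond_union_balls {F : ℝ → ℝ} (hF : Measurable F) {C : ℝ} (hC : ∀ x, ‖F x‖ ≤ C)
    {E : Set ℝ} {y₁ y₂ y₃ r₁ r₂ r₃ : ℝ} (h₁ : 0 < r₁) (h₂ : 0 < r₂) (h₃ : 0 < r₃)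
    (hd₁₂ : Disjoint (Metric.ball y₁ r₁) (Metric.ball y₂ r₂))
    (hd₁₃ : Disjoint (Metric.ball y₁ r₁) (Metric.ball y₃ r₃))
    (hd₂₃ : Disjoint (Metric.ball y₂ r₂) (Metric.ball y₃ r₃))
    (hE : E =ᵐ[volume]
      (Metric.ball y₁ r₁ ∪ Metric.ball y₂ r₂ ∪ Metric.ball y₃ r₃ : Set ℝ)) :
    ∫ x, F x ∂(ProbabilityTheory.cond volume E) =
      (2 * (r₁ + r₂ + r₃))⁻¹ * (r₁ * (∫ u in (-1 : ℝ)..1, F (y₁ + r₁ * u))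
        + r₂ * (∫ u in (-1 : ℝ)..1, F (y₂ + r₂ * u))
        + r₃ * (∫ u in (-1 : ℝ)..1, F (y₃ + r₃ * u))) := by
  have hi : ∀ y r : ℝ, IntegrableOn F (Metric.ball y r) := fun y r =>
    Measure.integrableOn_of_bounded measure_ball_lt_top.ne hF.aestronglyMeasurable
      (ae_of_all _ hC)
  have hd : Disjoint (Metric.ball y₁ r₁ ∪ Metric.ball y₂ r₂) (Metric.ball y₃ r₃) :=
    hd₁₃.union_left hd₂₃
  have hvol : (volume E).toReal = 2 * (r₁ + r₂ + r₃) := by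
    rw [measure_congr hE, measure_union hd measurableSet_ball,
      measure_union hd₁₂ measurableSet_ball]
    simp only [Real.volume_ball]
    rw [← ENNReal.ofReal_add (by positivity) (by positivity),
      ← ENNReal.ofReal_add (by positivity) (by positivity), ENNReal.toReal_ofReal (by positivity)]
    ring
  rw [ProbabilityTheory.cond, integral_smul_measure, ENNReal.toReal_inv, hvol, smul_eq_mul,
    Measure.restrict_congr_set hE,
    setIntegral_union hd measurableSet_ball ((hi _ _).union (hi _ _)) (hi _ _),
    setIntegral_union hd₁₂ measurableSet_ball (hi _ _) (hi _ _),
    setIntegral_ball_eq F _ h₁, setIntegral_ball_eq F _ h₂, setIntegral_ball_eq F _ h₃]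

lemma IsObservable.superlevel_ae_eq {ψ : ℝ → ℝ} {ε₁ ε₂ ε₃ τ : ℝ}
    (h : IsObservable ψ ε₁ ε₂ ε₃) (hτ : 0 < τ) {S : Set ℝ}
    (hsub : Metric.ball xi1 ε₁ ∪ Metric.ball xi2 ε₂ ∪ Metric.ball xi3 ε₃ ⊆ S)
    {n : ℕ} (hn : 0 < n) (h₁ : 1 * τ / (10 * n) < ε₁) (h₂ : 3 * τ / (10 * n) < ε₂)
    (h₃ : 1 * τ / (10 * n) < ε₃) :
    ({x ∈ S | ψ x > τ ^ (-2 : ℤ) * (100 * (n : ℝ) ^ 2)} : Set ℝ) =ᵐ[volume]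
      (Metric.ball xi1 (1 * τ / (10 * n)) ∪ Metric.ball xi2 (3 * τ / (10 * n)) ∪
        Metric.ball xi3 (1 * τ / (10 * n)) : Set ℝ) := by
  have hn' : (0 : ℝ) < n := by exact_mod_cast hn
  filter_upwards [compl_mem_ae_iff.2 (measure_singleton xi1),
    compl_mem_ae_iff.2 (measure_singleton xi2), compl_mem_ae_iff.2 (measure_singleton xi3)]
    with x n1 n2 n3
  have key : ∀ {ξ c ε : ℝ}, 0 < c → x ≠ ξ →
      (∀ x ∈ Metric.ball ξ ε, ψ x = c ^ 2 * |x - ξ| ^ (-2 : ℤ)) → x ∈ Metric.ball ξ ε →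
      (ψ x > τ ^ (-2 : ℤ) * (100 * (n : ℝ) ^ 2) ↔ x ∈ Metric.ball ξ (c * τ / (10 * n))) := by
    intro ξ c ε hc hne heq hx
    rw [heq x hx, gt_iff_lt, threshold_lt_iff hτ hc (abs_nonneg _) hn, Metric.mem_ball,
      Real.dist_eq, and_iff_right (abs_ne_zero.2 (sub_ne_zero.2 hne))]
  refine propext ⟨?_, ?_⟩
  · rintro ⟨-, hx⟩
    by_cases b1 : x ∈ Metric.ball xi1 ε₁
    · exact Or.inl (Or.inl ((key one_pos n1 h.eq₁ b1).1 hx))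
    by_cases b2 : x ∈ Metric.ball xi2 ε₂
    · exact Or.inl (Or.inr ((key three_pos n2 h.eq₂ b2).1 hx))
    by_cases b3 : x ∈ Metric.ball xi3 ε₃
    · exact Or.inr ((key one_pos n3 h.eq₃ b3).1 hx)
    · rw [h.eq₀ x b1 b2 b3] at hx
      exact absurd hx (not_lt.2 (by positivity))
  · rintro ((hx | hx) | hx)
    · have b := Metric.ball_subset_ball h₁.le hx
      exact ⟨hsub (Or.inl (Or.inl b)), (key one_pos n1 h.eq₁ b).2 hx⟩
    · have b := Metric.ball_subset_ball h₂.le hx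
      exact ⟨hsub (Or.inl (Or.inr b)), (key three_pos n2 h.eq₂ b).2 hx⟩
    · have b := Metric.ball_subset_ball h₃.le hx
      exact ⟨hsub (Or.inr b), (key one_pos n3 h.eq₃ b).2 hx⟩

/-- the law of `Vₙ(x) = (τ^{−1}(ψ(f^j x)/100n²)^{−1/2})_{0 ≤ j ≤ t}`
(with value `∞` where `ψ(f^j x) = 0`) under `Leb` conditioned on
`{ψ > τ^{−2}·100n²}` converges weakly to the law of `(Y_j)_{0 ≤ j ≤ t}`, i.e. the
corresponding integrals of every bounded continuous function converge. -/
theorem stmt16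
    (ε₁ ε₂ ε₃ : ℝ) (hε₁ : 0 < ε₁) (hε₂ : 0 < ε₂) (hε₃ : 0 < ε₃)
    (hd₁₂ : Disjoint (Metric.ball xi1 ε₁) (Metric.ball xi2 ε₂))
    (hd₁₃ : Disjoint (Metric.ball xi1 ε₁) (Metric.ball xi3 ε₃))
    (hd₂₃ : Disjoint (Metric.ball xi2 ε₂) (Metric.ball xi3 ε₃))
    (hsub : Metric.ball xi1 ε₁ ∪ Metric.ball xi2 ε₂ ∪ Metric.ball xi3 ε₃ ⊆ Ioo (0:ℝ) 1)
    (ψ : ℝ → ℝ)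
    (hψ₁ : ∀ x ∈ Metric.ball xi1 ε₁, ψ x = |x - xi1| ^ (-2 : ℤ))
    (hψ₂ : ∀ x ∈ Metric.ball xi2 ε₂, ψ x = 9 * |x - xi2| ^ (-2 : ℤ))
    (hψ₃ : ∀ x ∈ Metric.ball xi3 ε₃, ψ x = |x - xi3| ^ (-2 : ℤ))
    (hψ₀ : ∀ x, x ∉ Metric.ball xi1 ε₁ ∪ Metric.ball xi2 ε₂ ∪ Metric.ball xi3 ε₃ → ψ x = 0)
    (t : ℕ) (τ : ℝ) (hτ : 0 < τ)
    (V : ℕ → ℝ → (Fin (t + 1) → ℝ≥0∞))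
    (hV : ∀ (n : ℕ) (x : ℝ) (j : Fin (t + 1)),
      V n x j =
        if ψ (fD^[(j : ℕ)] x) = 0 then ⊤
        else ENNReal.ofReal
          (τ⁻¹ * (ψ (fD^[(j : ℕ)] x) / (100 * (n : ℝ) ^ 2)) ^ (-(1/2) : ℝ)))
    (E : ℕ → Set ℝ)
    (hE : ∀ n : ℕ, E n = {x ∈ Icc (0:ℝ) 1 | ψ x > τ ^ (-2 : ℤ) * (100 * (n : ℝ) ^ 2)}) :
    ∀ g : BoundedContinuousFunction (Fin (t + 1) → ℝ≥0∞) ℝ,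
      Tendsto
        (fun n : ℕ => ∫ x, g (V n x) ∂(ProbabilityTheory.cond volume (E n)))
        atTop (nhds (∫ v, g v ∂(limitLaw16 t))) := by
  intro g
  have h : IsObservable ψ ε₁ ε₂ ε₃ :=
    { pos₁ := hε₁
      pos₂ := hε₂
      pos₃ := hε₃
      eq₁ := fun x hx => by rw [hψ₁ x hx]; ring
      eq₂ := fun x hx => by rw [hψ₂ x hx]; ring
      eq₃ := fun x hx => by rw [hψ₃ x hx]; ring
      eq₀ := fun x h1 h2 h3 => hψ₀ x (by simp only [mem_union]; tauto) }
  obtain rfl : V = fun n x (j : Fin (t + 1)) => scaledInv τ n (ψ (fD^[(j : ℕ)] x)) := by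
    funext n x j; exact hV n x j
  have hVm : ∀ n : ℕ, Measurable fun (x : ℝ) (j : Fin (t + 1)) =>
      scaledInv τ n (ψ (fD^[(j : ℕ)] x)) := fun n => measurable_pi_lambda _ fun j =>
    (measurable_scaledInv τ n).comp (h.measurable.comp (measurable_fD.iterate j))
  have l1 := tendsto_integral_branch g hVm (r := fun n : ℕ => 1 * τ / (10 * n)) (measurable_g1 t)
    fun u hu => h.tendsto_branch₁ hτ hu t
  have l2 := tendsto_integral_branch g hVm (r := fun n : ℕ => 3 * τ / (10 * n)) (measurable_g2 t)
    fun u hu => h.tendsto_branch₂ hτ hu t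
  have l3 := tendsto_integral_branch g hVm (r := fun n : ℕ => 1 * τ / (10 * n)) (measurable_g3 t)
    fun u hu => h.tendsto_branch₃ hτ hu t
  have lim := ((l1.const_mul (1 / 10)).add (l2.const_mul (3 / 10))).add (l3.const_mul (1 / 10))
  rw [integral_limitLaw16]
  have hval : ∀ a b c : ℝ, 1 / 10 * (2 * a) + 3 / 10 * (2 * b) + 1 / 10 * (2 * c) =
      1 / 5 * a + 3 / 5 * b + 1 / 5 * c := fun a b c => by ring
  rw [hval] at lim
  refine lim.congr' ?_
  filter_upwards [eventually_gt_atTop 0,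
    (tendsto_div_ten_mul_natCast (1 * τ)).eventually (gt_mem_nhds hε₁),
    (tendsto_div_ten_mul_natCast (3 * τ)).eventually (gt_mem_nhds hε₂),
    (tendsto_div_ten_mul_natCast (1 * τ)).eventually (gt_mem_nhds hε₃)] with n hn b1 b2 b3
  have hn' : (0 : ℝ) < n := by exact_mod_cast hn
  have hae := h.superlevel_ae_eq hτ (hsub.trans Ioo_subset_Icc_self) hn b1 b2 b3
  rw [← hE n] at hae
  rw [integral_cond_union_balls (F := fun x => g fun j => scaledInv τ n (ψ (fD^[(j : ℕ)] x)))
    (g.continuous.measurable.comp (hVm n)) (fun x => g.norm_coe_le_norm _) (by positivity)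
    (by positivity) (by positivity)
    (hd₁₂.mono (Metric.ball_subset_ball b1.le) (Metric.ball_subset_ball b2.le))
    (hd₁₃.mono (Metric.ball_subset_ball b1.le) (Metric.ball_subset_ball b3.le))
    (hd₂₃.mono (Metric.ball_subset_ball b2.le) (Metric.ball_subset_ball b3.le)) hae]
  field_simp
  ring
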